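/- Let d ≥ 2 and α > d. For every ρ > 0, every i ∈ {1,2,3} and every δ > 0, the Poincaré constant satisfies γ^i(L) ≥ L^{1/δ}, P_{*,ρ}-a.s. for all sufficiently large L. -/

import Mathlib

open MeasureTheory Filter
open scoped ENNReal

noncomputable section

abbrev Pt (d : ℕ) := EuclideanSpace ℝ (Fin d)
abbrev Config (d : ℕ) := Set (Pt d)

def IsLocallyFinite {d : ℕ} (ξ : Config d) : Prop :=
  ∀ A : Set (Pt d), Bornology.IsBounded A → (ξ ∩ A).Finite

instance configMS (d : ℕ) : MeasurableSpace (Config d) :=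
  MeasurableSpace.generateFrom
    { E | ∃ (A : Set (Pt d)) (n : ℕ), Bornology.IsBounded A ∧ MeasurableSet A ∧
        E = {ξ : Config d | (ξ ∩ A).ncard = n} }

def IsPointProcess {d : ℕ} (P : Measure (Config d)) : Prop :=
  IsProbabilityMeasure P ∧ ∀ᵐ ξ ∂P, IsLocallyFinite ξ

def cube (d : ℕ) (L : ℝ) : Set (Pt d) := {p | ∀ i, |p i| ≤ L / 2}

/-- The cube `B_x = Kx + [0,K)^d`. -/
def Kcube (d : ℕ) (K : ℝ) (x : Fin d → ℤ) : Set (Pt d) :=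
  {p | ∀ i, K * x i ≤ p i ∧ p i < K * x i + K}

/-- Bernoulli(p) i.i.d. field on `ℤ^d`, characterized by its cylinder probabilities. -/
def IsBernoulliField (d : ℕ) (p : ℝ) (ν : Measure ((Fin d → ℤ) → Bool)) : Prop :=
  IsProbabilityMeasure ν ∧
  ∀ (S : Finset (Fin d → ℤ)) (b : (Fin d → ℤ) → Bool),
    ν {ω | ∀ x ∈ S, ω x = b x} = ∏ x ∈ S, ENNReal.ofReal (if b x then p else 1 - p)

/-- Assumption (A1): for every p < 1 there is K such that the good-box field
dominates an i.i.d. Bernoulli(p) field, in the sense of a monotone coupling. -/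
def AssumptionA1 {d : ℕ} (P : Measure (Config d)) : Prop :=
  ∀ p : ℝ, 0 < p → p < 1 → ∃ K : ℝ, 0 < K ∧
    ∃ (μ : Measure (Config d × ((Fin d → ℤ) → Bool))) (ν : Measure ((Fin d → ℤ) → Bool)),
      IsProbabilityMeasure μ ∧ IsBernoulliField d p ν ∧
      μ.map Prod.fst = P ∧ μ.map Prod.snd = ν ∧
      ∀ᵐ ω ∂μ, ∀ x : Fin d → ℤ, ω.2 x = true → (ω.1 ∩ Kcube d K x).Nonempty

/-- `R_A(ξ) = Σ_{x ∈ ξ∩A} Σ_{y ∈ ξ} exp(-|x-y|^α)` (valued in `ℝ≥0∞`). -/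
def Rfun {d : ℕ} (α : ℝ) (A : Set (Pt d)) (ξ : Config d) : ℝ≥0∞ :=
  ∑' (x : ↥(ξ ∩ A)) (y : ↥ξ), ENNReal.ofReal (Real.exp (-(dist (x : Pt d) (y : Pt d)) ^ α))

/-- The cube `V_x = L^ε x + [0, L^ε)^d`. -/
def Vcube (d : ℕ) (L : ℕ) (ε : ℝ) (x : Fin d → ℤ) : Set (Pt d) :=
  {p | ∀ i, (L : ℝ) ^ ε * x i ≤ p i ∧ p i < (L : ℝ) ^ ε * x i + (L : ℝ) ^ ε}

/-- Assumption (A2). -/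
def AssumptionA2 {d : ℕ} (α : ℝ) (P : Measure (Config d)) : Prop :=
  ∀ ε : ℝ, 0 < ε → ε < 1 → ∃ C : ℝ, 0 < C ∧
    ∀ᵐ ξ ∂P, ∀ᶠ L : ℕ in atTop,
      ∀ x : Fin d → ℤ, (Vcube d L ε x ∩ cube d L).Nonempty →
        Rfun α (Vcube d L ε x) ξ ≤ ENNReal.ofReal (C * (L : ℝ) ^ (ε * d))

noncomputable instance {d : ℕ} : DecidableEq (Pt d) := Classical.decEq _

variable {d : ℕ}

/-- jump rate `e^{-|x-y|^α}`. -/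
def rate (α : ℝ) (x y : Pt d) : ℝ := Real.exp (-(dist x y) ^ α)

/-- weights `w^i_x` for the three models `i = 1,2,3`. -/
def wgt (α : ℝ) (E : Finset (Pt d)) (i : ℕ) (x : Pt d) : ℝ :=
  if i = 1 then 1
  else if i = 2 then ∑ z ∈ E.erase x, rate α x z
  else max 1 (∑ z ∈ E.erase x, rate α x z)

/-- `W^i(U) = Σ_{x∈U} w^i_x`. -/
def Wsum (α : ℝ) (E : Finset (Pt d)) (i : ℕ) (U : Finset (Pt d)) : ℝ :=
  ∑ x ∈ U, wgt α E i x

/-- the reversible probability measure `ν^i(x) = w^i_x / W^i(ξ_L)`. -/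
def nu (α : ℝ) (E : Finset (Pt d)) (i : ℕ) (x : Pt d) : ℝ :=
  wgt α E i x / Wsum α E i E

/-- conductance `I^i_U`. -/
def conduct (α : ℝ) (E : Finset (Pt d)) (i : ℕ) (U : Finset (Pt d)) : ℝ :=
  (∑ x ∈ U, ∑ y ∈ E \ U, rate α x y) / Wsum α E i U

/-- isoperimetric profile `φ^i_L(t)` (valued in `ℝ≥0∞`; `∞` if no admissible `U`). -/
def isoProfile (α : ℝ) (E : Finset (Pt d)) (i : ℕ) (t : ℝ) : ℝ≥0∞ :=
  ⨅ (U : Finset (Pt d)) (_ : U ⊆ E) (_ : U.Nonempty)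
    (_ : Wsum α E i U ≤ t * Wsum α E i E), ENNReal.ofReal (conduct α E i U)

/-- Cheeger's constant `Φ^i_L = φ^i_L(1/2)`. -/
def cheeger (α : ℝ) (E : Finset (Pt d)) (i : ℕ) : ℝ≥0∞ := isoProfile α E i (1 / 2)

/-- Dirichlet form `E_i(f)`. -/
def dirichlet (α : ℝ) (E : Finset (Pt d)) (i : ℕ) (f : Pt d → ℝ) : ℝ :=
  (1 / 2) * ∑ x ∈ E, ∑ y ∈ E.erase x,
    nu α E i x * (rate α x y / wgt α E i x) * (f x - f y) ^ 2

/-- variance `Var_i(f) = ν^i(f²) - ν^i(f)²`. -/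
def varNu (α : ℝ) (E : Finset (Pt d)) (i : ℕ) (f : Pt d → ℝ) : ℝ :=
  (∑ x ∈ E, nu α E i x * f x ^ 2) - (∑ x ∈ E, nu α E i x * f x) ^ 2

/-- nonconstant on `E`. -/
def Nonconst (E : Finset (Pt d)) (f : Pt d → ℝ) : Prop := ∃ x ∈ E, ∃ y ∈ E, f x ≠ f y

/-- Poincaré constant `γ^i(L) = sup { Var_i f / E_i f : f nonconstant }`. -/
def gammaP (α : ℝ) (E : Finset (Pt d)) (i : ℕ) : ℝ≥0∞ :=
  ⨆ (f : Pt d → ℝ) (_ : Nonconst E f),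
    ENNReal.ofReal (varNu α E i f / dirichlet α E i f)

/-- the generator `L^i` as a matrix on `E`. -/
def gen (α : ℝ) (E : Finset (Pt d)) (i : ℕ) : Matrix ↥E ↥E ℝ :=
  Matrix.of fun x y =>
    if x = y then -(∑ z ∈ E.erase (x : Pt d), rate α (x : Pt d) z / wgt α E i (x : Pt d))
    else rate α (x : Pt d) (y : Pt d) / wgt α E i (x : Pt d)

/-- heat kernel `H^i_t = exp(t L^i)`, via the exponential series. -/
def heatKernel (α : ℝ) (E : Finset (Pt d)) (i : ℕ) (t : ℝ) (x y : ↥E) : ℝ :=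
  ∑' n : ℕ, t ^ n / (n.factorial : ℝ) * (gen α E i ^ n) x y

/-- uniform mixing time `τ^i(L)` (valued in `ℝ≥0∞`). -/
def mixTime (α : ℝ) (E : Finset (Pt d)) (i : ℕ) : ℝ≥0∞ :=
  ⨅ (t : ℝ) (_ : 0 < t)
    (_ : ∀ x y : ↥E,
      |heatKernel α E i t x y - nu α E i (y : Pt d)| / nu α E i (y : Pt d) ≤ Real.exp (-1)),
    ENNReal.ofReal t

/-- `c₀⁺(U)`: nonnegative, nonconstant, vanishing outside `U`. -/
def c0plus (E U : Finset (Pt d)) (f : Pt d → ℝ) : Prop :=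
  (∀ x ∈ E, 0 ≤ f x) ∧ Nonconst E f ∧ ∀ x ∈ E, x ∉ U → f x = 0

/-- `λ^i(U) = inf { E_i f / Var_i f : f ∈ c₀⁺(U) }`. -/
def lambdaU (α : ℝ) (E : Finset (Pt d)) (i : ℕ) (U : Finset (Pt d)) : ℝ :=
  sInf {r : ℝ | ∃ f : Pt d → ℝ, c0plus E U f ∧ r = dirichlet α E i f / varNu α E i f}

/-- `ν^i_* = min_{x∈E} ν^i(x)`. -/
def nuStar (α : ℝ) (E : Finset (Pt d)) (i : ℕ) : ℝ :=
  sInf (nu α E i '' ↑E)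

/-- `ν^i(U)` for a subset `U`. -/
def nuSet (α : ℝ) (E : Finset (Pt d)) (i : ℕ) (U : Finset (Pt d)) : ℝ :=
  ∑ x ∈ U, nu α E i x

/-- spectral profile `Λ^i(r)`. -/
def specProfile (α : ℝ) (E : Finset (Pt d)) (i : ℕ) (r : ℝ) : ℝ :=
  sInf {l : ℝ | ∃ U : Finset (Pt d), U ⊆ E ∧
    nuStar α E i ≤ nuSet α E i U ∧ nuSet α E i U ≤ r ∧ l = lambdaU α E i U}

/-- hybrid conductance profile `ψ_L(t)`: model-3 conductance, counting constraint. -/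
def hybridProfile (α : ℝ) (E : Finset (Pt d)) (t : ℝ) : ℝ≥0∞ :=
  ⨅ (U : Finset (Pt d)) (_ : U ⊆ E) (_ : U.Nonempty)
    (_ : (U.card : ℝ) ≤ t * (E.card : ℝ)), ENNReal.ofReal (conduct α E 3 U)

/-- homogeneous Poisson point process of intensity `ρ`, characterized by
independence and Poisson distribution of the counting variables. -/
def IsPoissonPP (d : ℕ) (ρ : ℝ) (P : Measure (Config d)) : Prop :=
  IsProbabilityMeasure P ∧ (∀ᵐ ξ ∂P, IsLocallyFinite ξ) ∧
  ∀ (k : ℕ) (A : Fin k → Set (Pt d)),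
    (∀ j, Bornology.IsBounded (A j)) → (∀ j, MeasurableSet (A j)) →
    (Pairwise fun j j' => Disjoint (A j) (A j')) →
    ∀ m : Fin k → ℕ,
      P {ξ | ∀ j, (ξ ∩ A j).ncard = m j} =
        ∏ j, ENNReal.ofReal (Real.exp (-ρ * (volume (A j)).toReal) *
          (ρ * (volume (A j)).toReal) ^ (m j) / ((m j).factorial : ℝ))

lemma rate_pos (α : ℝ) (x y : Pt d) : 0 < rate α x y := Real.exp_pos _

lemma rate_le_one (α : ℝ) (x y : Pt d) : rate α x y ≤ 1 :=
  Real.exp_le_one_iff.2 (neg_nonpos.2 (Real.rpow_nonneg dist_nonneg _))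

lemma rate_le_of_le_dist {α s : ℝ} (hα : 0 ≤ α) (hs : 0 ≤ s) {x y : Pt d} (h : s ≤ dist x y) :
    rate α x y ≤ Real.exp (-s ^ α) :=
  Real.exp_le_exp.2 (neg_le_neg (Real.rpow_le_rpow hs h hα))

lemma exp_neg_one_le_rate {α : ℝ} (hα : 0 ≤ α) {x y : Pt d} (h : dist x y ≤ 1) :
    Real.exp (-1) ≤ rate α x y :=
  Real.exp_le_exp.2 (neg_le_neg (Real.rpow_le_one dist_nonneg h hα))

lemma wgt_pos {α : ℝ} {E : Finset (Pt d)} (i : ℕ) {x y : Pt d} (hy : y ∈ E) (hxy : y ≠ x) :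
    0 < wgt α E i x := by
  unfold wgt
  split_ifs
  · exact one_pos
  · exact Finset.sum_pos (fun z _ => rate_pos α x z) ⟨y, Finset.mem_erase.2 ⟨hxy, hy⟩⟩
  · exact lt_max_of_lt_left one_pos

lemma wgt_le_card {α : ℝ} {E : Finset (Pt d)} (i : ℕ) {x : Pt d} (hx : x ∈ E) :
    wgt α E i x ≤ E.card := by
  have h1 : (1 : ℝ) ≤ E.card := by exact_mod_cast Finset.card_pos.2 ⟨x, hx⟩
  have h2 : ∑ z ∈ E.erase x, rate α x z ≤ E.card :=
    calc ∑ z ∈ E.erase x, rate α x z ≤ ∑ z ∈ E.erase x, (1 : ℝ) :=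
          Finset.sum_le_sum fun z _ => rate_le_one α x z
      _ = ((E.erase x).card : ℝ) := by simp
      _ ≤ (E.card : ℝ) := by exact_mod_cast Finset.card_le_card (Finset.erase_subset _ _)
  unfold wgt
  split_ifs
  · exact h1
  · exact h2
  · exact max_le h1 h2

lemma exp_neg_one_le_wgt {α : ℝ} (hα : 0 ≤ α) {E : Finset (Pt d)} (i : ℕ) {x y : Pt d}
    (hy : y ∈ E) (hxy : y ≠ x) (h : dist x y ≤ 1) : Real.exp (-1) ≤ wgt α E i x := by
  unfold wgt
  split_ifs
  · exact Real.exp_le_one_iff.2 (by norm_num)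
  · exact (exp_neg_one_le_rate hα h).trans
      (Finset.single_le_sum (f := fun z => rate α x z) (fun z _ => (rate_pos α x z).le)
        (Finset.mem_erase.2 ⟨hxy, hy⟩))
  · exact le_max_of_le_left (Real.exp_le_one_iff.2 (by norm_num))

/-- The indicator of a set `U` at distance at least `s` from `E \ U` bounds the Poincaré constant
from below, as soon as `U` and `E \ U` both contain two points at distance at most one. -/
lemma ofReal_le_gammaP {α s : ℝ} (hα : 0 ≤ α) (hs : 0 ≤ s) {E U : Finset (Pt d)} (i : ℕ)
    (hUE : U ⊆ E)
    (hU : ∃ x ∈ U, ∃ y ∈ U, y ≠ x ∧ dist x y ≤ 1)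
    (hV : ∃ x ∈ E \ U, ∃ y ∈ E \ U, y ≠ x ∧ dist x y ≤ 1)
    (hcut : ∀ x ∈ U, ∀ y ∈ E \ U, s ≤ dist x y) :
    ENNReal.ofReal (Real.exp (-2) * Real.exp (s ^ α) / (E.card : ℝ) ^ 4) ≤ gammaP α E i := by
  obtain ⟨x, hx, y, hy, hyx, hxy⟩ := hU
  obtain ⟨x', hx', y', hy', hyx', hxy'⟩ := hV
  have hxE := hUE hx
  have hyE := hUE hy
  have hx'E := (Finset.mem_sdiff.1 hx').1
  have hy'E := (Finset.mem_sdiff.1 hy').1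
  have hx'U := (Finset.mem_sdiff.1 hx').2
  have hpos : ∀ z ∈ E, 0 < wgt α E i z := by
    intro z _
    by_cases hz : x = z
    · subst hz; exact wgt_pos i hyE hyx
    · exact wgt_pos i hxE hz
  have hNpos : (0 : ℝ) < E.card := by exact_mod_cast Finset.card_pos.2 ⟨x, hxE⟩
  set N : ℝ := (E.card : ℝ) with hN
  set f : Pt d → ℝ := fun z => if z ∈ U then 1 else 0 with hf
  set W := Wsum α E i E with hW
  set a := ∑ z ∈ U, wgt α E i z with ha
  set b := ∑ z ∈ E \ U, wgt α E i z with hb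
  have ha1 : Real.exp (-1) ≤ a := (exp_neg_one_le_wgt hα i hyE hyx hxy).trans
    (Finset.single_le_sum (fun z hz => (hpos z (hUE hz)).le) hx)
  have hb1 : Real.exp (-1) ≤ b := (exp_neg_one_le_wgt hα i hy'E hyx' hxy').trans
    (Finset.single_le_sum (fun z hz => (hpos z (Finset.mem_sdiff.1 hz).1).le) hx')
  have he1 : 0 < Real.exp (-1) := Real.exp_pos _
  have hWab : W = a + b := by
    rw [hW, ha, hb, Wsum, add_comm, Finset.sum_sdiff hUE]
  have hWpos : 0 < W := by linarith
  have hWle : W ≤ N ^ 2 :=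
    calc W ≤ ∑ z ∈ E, N := Finset.sum_le_sum fun z hz => wgt_le_card i hz
      _ = N ^ 2 := by rw [Finset.sum_const, nsmul_eq_mul]; ring
  have hnuf : ∑ z ∈ E, nu α E i z * f z = a / W := by
    rw [ha, Finset.sum_div, ← Finset.sum_subset hUE]
    · refine Finset.sum_congr rfl fun z hz => ?_
      simp [hf, hz, nu, hW]
    · intro z _ hz
      simp [hf, hz]
  have hvar : varNu α E i f = a * b / W ^ 2 := by
    have hsq : ∀ z, f z ^ 2 = f z := by
      intro z; by_cases hz : z ∈ U <;> simp [hf, hz]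
    unfold varNu
    simp_rw [hsq]
    rw [hnuf]
    have : W ≠ 0 := hWpos.ne'
    field_simp
    rw [hWab]; ring
  have hterm : ∀ z ∈ E, ∀ u, nu α E i z * (rate α z u / wgt α E i z) * (f z - f u) ^ 2
      = rate α z u * (f z - f u) ^ 2 / W := by
    intro z hz u
    have h1 := (hpos z hz).ne'
    have h2 : W ≠ 0 := hWpos.ne'
    unfold nu
    rw [← hW]
    field_simp
  have hnn : ∀ z ∈ E, ∀ u, 0 ≤ nu α E i z * (rate α z u / wgt α E i z) * (f z - f u) ^ 2 := by
    intro z hz u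
    rw [hterm z hz u]
    have := rate_pos α z u
    positivity
  have hdle : dirichlet α E i f ≤ 1 / 2 * (N ^ 2 * (Real.exp (-s ^ α) / W)) := by
    unfold dirichlet
    refine mul_le_mul_of_nonneg_left ?_ (by norm_num)
    calc ∑ z ∈ E, ∑ u ∈ E.erase z, nu α E i z * (rate α z u / wgt α E i z) * (f z - f u) ^ 2
        ≤ ∑ z ∈ E, ∑ u ∈ E, nu α E i z * (rate α z u / wgt α E i z) * (f z - f u) ^ 2 :=
          Finset.sum_le_sum fun z hz => Finset.sum_le_sum_of_subset_of_nonneg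
            (Finset.erase_subset _ _) fun u _ _ => hnn z hz u
      _ ≤ ∑ z ∈ E, ∑ u ∈ E, Real.exp (-s ^ α) / W := by
          refine Finset.sum_le_sum fun z hz => Finset.sum_le_sum fun u hu => ?_
          rw [hterm z hz u]
          refine div_le_div_of_nonneg_right ?_ hWpos.le
          by_cases hzU : z ∈ U <;> by_cases huU : u ∈ U
          · simp [hf, hzU, huU, Real.exp_nonneg]
          · simpa [hf, hzU, huU] using
              rate_le_of_le_dist hα hs (hcut z hzU u (Finset.mem_sdiff.2 ⟨hu, huU⟩))
          · simpa [hf, hzU, huU] using rate_le_of_le_dist hα hs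
              (dist_comm u z ▸ hcut u huU z (Finset.mem_sdiff.2 ⟨hz, hzU⟩))
          · simp [hf, hzU, huU, Real.exp_nonneg]
      _ = N ^ 2 * (Real.exp (-s ^ α) / W) := by
          simp only [Finset.sum_const, nsmul_eq_mul]; ring
  have hxx' : x' ≠ x := fun h => hx'U (h ▸ hx)
  have hdpos : 0 < dirichlet α E i f := by
    unfold dirichlet
    refine mul_pos (by norm_num) ?_
    refine Finset.sum_pos' (fun z hz => Finset.sum_nonneg fun u _ => hnn z hz u)
      ⟨x, hxE, Finset.sum_pos' (fun u _ => hnn x hxE u)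
        ⟨x', Finset.mem_erase.2 ⟨hxx', hx'E⟩, ?_⟩⟩
    rw [hterm x hxE]
    have := rate_pos α x x'
    have hfx : (f x - f x') ^ 2 = 1 := by simp [hf, hx, hx'U]
    rw [hfx]; positivity
  have hnc : Nonconst E f := ⟨x, hxE, x', hx'E, by simp [hf, hx, hx'U]⟩
  refine le_iSup₂_of_le f hnc (ENNReal.ofReal_le_ofReal ?_)
  rw [le_div_iff₀ hdpos, hvar]
  have hab : Real.exp (-2) ≤ a * b := by
    have : Real.exp (-2) = Real.exp (-1) * Real.exp (-1) := by
      rw [← Real.exp_add]; norm_num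
    rw [this]
    exact mul_le_mul ha1 hb1 he1.le (he1.le.trans ha1)
  calc Real.exp (-2) * Real.exp (s ^ α) / N ^ 4 * dirichlet α E i f
      ≤ Real.exp (-2) * Real.exp (s ^ α) / N ^ 4 *
          (1 / 2 * (N ^ 2 * (Real.exp (-s ^ α) / W))) := by gcongr
    _ = Real.exp (-2) / (2 * N ^ 2 * W) := by
        rw [Real.exp_neg (s ^ α)]
        have := (Real.exp_pos (s ^ α)).ne'
        field_simp
    _ ≤ a * b / (2 * N ^ 2 * W) := by gcongr
    _ ≤ a * b / W ^ 2 := by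
        have h0 : 0 ≤ a * b := (Real.exp_pos _).le.trans hab
        refine div_le_div_of_nonneg_left h0 (by positivity) ?_
        nlinarith

lemma measurableSet_ncard_eq {A : Set (Pt d)} (hA : Bornology.IsBounded A) (hm : MeasurableSet A)
    (n : ℕ) : MeasurableSet {ξ : Config d | (ξ ∩ A).ncard = n} :=
  MeasurableSpace.measurableSet_generateFrom ⟨A, n, hA, hm, rfl⟩

lemma IsPoissonPP.measure_ncard_eq {ρ : ℝ} {P : Measure (Config d)} (hP : IsPoissonPP d ρ P)
    {A : Set (Pt d)} (hA : Bornology.IsBounded A) (hm : MeasurableSet A) (n : ℕ) :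
    P {ξ | (ξ ∩ A).ncard = n} =
      ENNReal.ofReal (Real.exp (-ρ * (volume A).toReal) *
        (ρ * (volume A).toReal) ^ n / (n.factorial : ℝ)) := by
  have := hP.2.2 1 (fun _ => A) (fun _ => hA) (fun _ => hm)
    (fun j j' h => absurd (Subsingleton.elim j j') h) (fun _ => n)
  simpa using this

lemma IsPoissonPP.measure_forall_ncard_eq {ρ : ℝ} {P : Measure (Config d)}
    (hP : IsPoissonPP d ρ P) {ι : Type*} [Fintype ι] (A : ι → Set (Pt d))
    (hA : ∀ j, Bornology.IsBounded (A j)) (hm : ∀ j, MeasurableSet (A j))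
    (hd : Pairwise fun j j' => Disjoint (A j) (A j')) (m : ι → ℕ) :
    P {ξ | ∀ j, (ξ ∩ A j).ncard = m j} = ∏ j, P {ξ | (ξ ∩ A j).ncard = m j} := by
  let e := Fintype.equivFin ι
  have h := hP.2.2 _ (A ∘ e.symm) (fun j => hA _) (fun j => hm _)
    (fun j j' hj => hd (e.symm.injective.ne hj)) (m ∘ e.symm)
  have hset : {ξ : Config d | ∀ j, (ξ ∩ A j).ncard = m j} =
      {ξ | ∀ j, (ξ ∩ (A ∘ e.symm) j).ncard = (m ∘ e.symm) j} := by
    ext ξ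
    exact (e.symm.forall_congr_right (q := fun j => (ξ ∩ A j).ncard = m j)).symm
  rw [hset, h, ← e.symm.prod_comp]
  exact Finset.prod_congr rfl fun j _ => (hP.measure_ncard_eq (hA _) (hm _) _).symm

lemma IsPoissonPP.measure_le_ncard {ρ : ℝ} (hρ : 0 ≤ ρ) {P : Measure (Config d)}
    (hP : IsPoissonPP d ρ P) {A : Set (Pt d)} (hA : Bornology.IsBounded A) (hm : MeasurableSet A)
    {n : ℕ} (hn : n ≠ 0) :
    P {ξ | n ≤ (ξ ∩ A).ncard} ≤ ENNReal.ofReal (ρ * (volume A).toReal / n) := by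
  have := hP.1
  set r := ρ * (volume A).toReal with hr
  have hr0 : 0 ≤ r := mul_nonneg hρ ENNReal.toReal_nonneg
  set X : Config d → ℕ := fun ξ => (ξ ∩ A).ncard with hX
  have hXm : Measurable X := measurable_to_countable' fun k => measurableSet_ncard_eq hA hm k
  have hXk : ∀ k : ℕ, P.map X {k} = ENNReal.ofReal (Real.exp (-r) * r ^ k / (k.factorial : ℝ)) := by
    intro k
    rw [Measure.map_apply hXm (measurableSet_singleton k)]
    have := hP.measure_ncard_eq hA hm k
    rw [neg_mul] at this
    exact this
  have hprob : IsProbabilityMeasure (P.map X) := Measure.isProbabilityMeasure_map hXm.aemeasurable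
  have hmean : ∫⁻ ξ, (X ξ : ℝ≥0∞) ∂P = ENNReal.ofReal r := by
    rw [← lintegral_map (f := fun k : ℕ => (k : ℝ≥0∞)) (by fun_prop) hXm, lintegral_countable',
      tsum_eq_zero_add' ENNReal.summable]
    have hstep : ∀ k : ℕ, ((k + 1 : ℕ) : ℝ≥0∞) * P.map X {k + 1} =
        ENNReal.ofReal r * P.map X {k} := by
      intro k
      rw [hXk, hXk, ← ENNReal.ofReal_natCast, ← ENNReal.ofReal_mul (by positivity),
        ← ENNReal.ofReal_mul hr0]
      congr 1
      rw [Nat.factorial_succ]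
      push_cast
      field_simp
      ring
    simp_rw [hstep]
    rw [ENNReal.tsum_mul_left]
    have : ∑' k : ℕ, P.map X {k} = 1 := by
      rw [← measure_univ (μ := P.map X)]
      simpa using (lintegral_countable' (μ := P.map X) (fun _ : ℕ => (1 : ℝ≥0∞))).symm
    simp [this]
  have hmk := meas_ge_le_lintegral_div (μ := P) (f := fun ξ => (X ξ : ℝ≥0∞))
    (by fun_prop) (ε := (n : ℝ≥0∞)) (by simpa using hn) (by simp)
  rw [hmean] at hmk
  rw [ENNReal.ofReal_div_of_pos (by positivity), ENNReal.ofReal_natCast]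
  simpa [hX] using hmk

/-- The event that `ball c (1 / 2)` holds exactly two points, and `ball c (s + 1)` no others. -/
def IsolatedPair (c : Pt d) (s : ℝ) : Set (Config d) :=
  {ξ | (ξ ∩ Metric.ball c (1 / 2)).ncard = 2 ∧
    (ξ ∩ (Metric.ball c (s + 1) \ Metric.ball c (1 / 2))).ncard = 0}

lemma measurableSet_isolatedPair (c : Pt d) (s : ℝ) : MeasurableSet (IsolatedPair c s) :=
  (measurableSet_ncard_eq Metric.isBounded_ball measurableSet_ball 2).inter
    (measurableSet_ncard_eq (Metric.isBounded_ball.subset Set.sdiff_subset)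
      (measurableSet_ball.diff measurableSet_ball) 0)

/-- The inner ball (`true`) and the surrounding annulus (`false`) of an isolated pair. -/
def pairRegion (c : Pt d) (s : ℝ) (b : Bool) : Set (Pt d) :=
  if b then Metric.ball c (1 / 2) else Metric.ball c (s + 1) \ Metric.ball c (1 / 2)

lemma isBounded_pairRegion (c : Pt d) (s : ℝ) (b : Bool) :
    Bornology.IsBounded (pairRegion c s b) := by
  cases b
  · exact Metric.isBounded_ball.subset Set.sdiff_subset
  · exact Metric.isBounded_ball

lemma measurableSet_pairRegion (c : Pt d) (s : ℝ) (b : Bool) :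
    MeasurableSet (pairRegion c s b) := by
  cases b
  · exact measurableSet_ball.diff measurableSet_ball
  · exact measurableSet_ball

lemma pairRegion_subset_ball (c : Pt d) {s : ℝ} (hs : 0 ≤ s) (b : Bool) :
    pairRegion c s b ⊆ Metric.ball c (s + 1) := by
  cases b
  · exact Set.sdiff_subset
  · exact Metric.ball_subset_ball (by linarith)

lemma pairwise_disjoint_pairRegion (c : Pt d) (s : ℝ) :
    Pairwise fun b b' => Disjoint (pairRegion c s b) (pairRegion c s b') := by
  intro b b' h
  cases b <;> cases b'
  · exact absurd rfl h
  · exact Set.disjoint_sdiff_left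
  · exact Set.disjoint_sdiff_right
  · exact absurd rfl h

lemma isolatedPair_eq (c : Pt d) (s : ℝ) :
    IsolatedPair c s = {ξ | ∀ b, (ξ ∩ pairRegion c s b).ncard = if b then 2 else 0} := by
  ext ξ
  simp [IsolatedPair, pairRegion, and_comm]

lemma IsPoissonPP.measure_isolatedPair {ρ : ℝ} {P : Measure (Config d)} (hP : IsPoissonPP d ρ P)
    (c : Pt d) (s : ℝ) : P (IsolatedPair c s) =
      ∏ b, P {ξ | (ξ ∩ pairRegion c s b).ncard = if b then 2 else 0} := by
  rw [isolatedPair_eq]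
  exact hP.measure_forall_ncard_eq _ (isBounded_pairRegion c s) (measurableSet_pairRegion c s)
    (pairwise_disjoint_pairRegion c s) _

lemma IsPoissonPP.iIndepSet_isolatedPair {ρ : ℝ} {P : Measure (Config d)}
    (hP : IsPoissonPP d ρ P) {κ : Type*} {c : κ → Pt d} {s : ℝ} (hs : 0 ≤ s)
    (hc : Pairwise fun k l => 2 * (s + 1) ≤ dist (c k) (c l)) :
    ProbabilityTheory.iIndepSet (fun k => IsolatedPair (c k) s) P := by
  have := hP.1
  rw [ProbabilityTheory.iIndepSet_iff_meas_biInter fun k => measurableSet_isolatedPair _ _]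
  intro S
  have hset : (⋂ k ∈ S, IsolatedPair (c k) s) = {ξ | ∀ j : S × Bool,
      (ξ ∩ pairRegion (c j.1) s j.2).ncard = if j.2 then 2 else 0} := by
    ext ξ
    simp only [isolatedPair_eq, Set.mem_iInter, Set.mem_ofPred_eq, Prod.forall, Subtype.forall]
  rw [hset, hP.measure_forall_ncard_eq (fun j : S × Bool => pairRegion (c j.1) s j.2)
    (fun j => isBounded_pairRegion _ _ _) (fun j => measurableSet_pairRegion _ _ _) ?_
    (fun j => if j.2 then 2 else 0), Fintype.prod_prod_type]
  · rw [← Finset.prod_coe_sort S (fun k => P (IsolatedPair (c k) s))]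
    refine Finset.prod_congr rfl fun k _ => ?_
    rw [hP.measure_isolatedPair]
  · rintro ⟨k, b⟩ ⟨l, b'⟩ h
    by_cases hkl : k = l
    · subst hkl
      exact pairwise_disjoint_pairRegion _ _ fun hb => h (Prod.ext rfl hb)
    · refine (Metric.ball_disjoint_ball ?_).mono (pairRegion_subset_ball _ hs b)
        (pairRegion_subset_ball _ hs b')
      have := hc (fun h' => hkl (Subtype.ext h'))
      linarith

lemma IsPoissonPP.le_measure_isolatedPair {ρ : ℝ} (hρ : 0 < ρ) :
    ∃ q κ : ℝ, 0 < q ∧ 0 < κ ∧ ∀ (P : Measure (Config d)), IsPoissonPP d ρ P →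
      ∀ (c : Pt d) (s : ℝ), 0 ≤ s →
        ENNReal.ofReal (q * Real.exp (-(κ * (s + 1) ^ d))) ≤ P (IsolatedPair c s) := by
  set v := (volume (Metric.ball (0 : Pt d) (1 / 2))).toReal with hv
  have hfin : ∀ (c : Pt d) (r : ℝ), volume (Metric.ball c r) ≠ ∞ := fun c r =>
    measure_ball_lt_top.ne
  have hpos : ∀ r : ℝ, 0 < r → 0 < (volume (Metric.ball (0 : Pt d) r)).toReal := fun r hr =>
    ENNReal.toReal_pos (Metric.measure_ball_pos _ _ hr).ne' (hfin _ _)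
  have hv0 : 0 < v := hpos _ (by norm_num)
  have hu0 := hpos 1 one_pos
  refine ⟨Real.exp (-ρ * v) * (ρ * v) ^ 2 / 2,
    ρ * (volume (Metric.ball (0 : Pt d) 1)).toReal, by positivity, by positivity, ?_⟩
  intro P hP c s hs
  rw [hP.measure_isolatedPair, Fintype.prod_bool,
    hP.measure_ncard_eq (isBounded_pairRegion _ _ _) (measurableSet_pairRegion _ _ _),
    hP.measure_ncard_eq (isBounded_pairRegion _ _ _) (measurableSet_pairRegion _ _ _),
    ← ENNReal.ofReal_mul (by positivity)]
  refine ENNReal.ofReal_le_ofReal ?_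
  have h1 : (volume (pairRegion c s true)).toReal = v := by
    simp only [pairRegion, if_true, hv]
    rw [Measure.addHaar_ball_center]
  have h2 : (volume (pairRegion c s false)).toReal ≤
      (s + 1) ^ d * (volume (Metric.ball (0 : Pt d) 1)).toReal := by
    refine (ENNReal.toReal_mono (hfin _ _) (measure_mono (pairRegion_subset_ball c hs _))).trans ?_
    rw [Measure.addHaar_ball_of_pos _ _ (by positivity), ENNReal.toReal_mul,
      ENNReal.toReal_ofReal (by positivity)]
    simp
  rw [h1]
  simp only [if_true, Bool.false_eq_true, if_false, pow_zero, mul_one, Nat.factorial]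
  norm_num
  refine mul_le_mul_of_nonneg_left (Real.exp_le_exp.2 ?_) (by positivity)
  nlinarith

lemma IsPoissonPP.measure_forall_notMem_isolatedPair_le {ρ : ℝ} {P : Measure (Config d)}
    (hP : IsPoissonPP d ρ P) {κ : Type*} {c : κ → Pt d} {s : ℝ} (hs : 0 ≤ s)
    (hc : Pairwise fun k l => 2 * (s + 1) ≤ dist (c k) (c l)) {p : ℝ} (hp : 0 ≤ p)
    (hle : ∀ k, ENNReal.ofReal p ≤ P (IsolatedPair (c k) s)) (S : Finset κ) :
    P {ξ | ∀ k ∈ S, ξ ∉ IsolatedPair (c k) s} ≤ ENNReal.ofReal (Real.exp (-(S.card * p))) := by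
  have := hP.1
  have hset : {ξ | ∀ k ∈ S, ξ ∉ IsolatedPair (c k) s} = ⋂ k ∈ S, (IsolatedPair (c k) s)ᶜ := by
    ext ξ; simp
  have hcompl : ∀ k, P (IsolatedPair (c k) s)ᶜ ≤ ENNReal.ofReal (Real.exp (-p)) := by
    intro k
    rw [prob_compl_eq_one_sub (measurableSet_isolatedPair _ _)]
    calc 1 - P (IsolatedPair (c k) s) ≤ ENNReal.ofReal 1 - ENNReal.ofReal p := by
          rw [ENNReal.ofReal_one]; exact tsub_le_tsub_left (hle k) 1
      _ = ENNReal.ofReal (1 - p) := (ENNReal.ofReal_sub 1 hp).symm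
      _ ≤ _ := ENNReal.ofReal_le_ofReal (Real.one_sub_le_exp_neg p)
  rw [hset, (ProbabilityTheory.iIndepSet_iff _ _).1 (hP.iIndepSet_isolatedPair hs hc) S
    fun k _ => (MeasurableSpace.measurableSet_generateFrom (Set.mem_singleton _)).compl]
  calc ∏ k ∈ S, P (IsolatedPair (c k) s)ᶜ
      ≤ ∏ _k ∈ S, ENNReal.ofReal (Real.exp (-p)) := Finset.prod_le_prod' fun k _ => hcompl k
    _ = ENNReal.ofReal (Real.exp (-(S.card * p))) := by
        rw [Finset.prod_const, ← ENNReal.ofReal_pow (Real.exp_nonneg _), ← Real.exp_nat_mul]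
        ring_nf

lemma ofReal_le_gammaP_of_isolatedPair {α s : ℝ} (hα : 0 ≤ α) (hs : 0 ≤ s) {ξ : Config d}
    (hξ : IsLocallyFinite ξ) {c c' : Pt d} (hcc' : 2 * (s + 1) ≤ dist c c')
    (hc : ξ ∈ IsolatedPair c s) (hc' : ξ ∈ IsolatedPair c' s) {A : Set (Pt d)}
    (hA : Metric.ball c (1 / 2) ⊆ A) (hA' : Metric.ball c' (1 / 2) ⊆ A) (hfin : (ξ ∩ A).Finite)
    (i : ℕ) :
    ENNReal.ofReal (Real.exp (-2) * Real.exp (s ^ α) / (hfin.toFinset.card : ℝ) ^ 4) ≤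
      gammaP α hfin.toFinset i := by
  classical
  obtain ⟨x, y, hxy, hpair⟩ := Set.ncard_eq_two.1 hc.1
  obtain ⟨x', y', hxy', hpair'⟩ := Set.ncard_eq_two.1 hc'.1
  have hempty := (Set.ncard_eq_zero
    (hξ _ (Metric.isBounded_ball.subset Set.sdiff_subset))).1 hc.2
  have hx : x ∈ ξ ∩ Metric.ball c (1 / 2) := hpair ▸ Set.mem_insert _ _
  have hy : y ∈ ξ ∩ Metric.ball c (1 / 2) := hpair ▸ Set.mem_insert_of_mem _ rfl
  have hx' : x' ∈ ξ ∩ Metric.ball c' (1 / 2) := hpair' ▸ Set.mem_insert _ _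
  have hy' : y' ∈ ξ ∩ Metric.ball c' (1 / 2) := hpair' ▸ Set.mem_insert_of_mem _ rfl
  have hclose : ∀ {e u v : Pt d}, u ∈ Metric.ball e (1 / 2) → v ∈ Metric.ball e (1 / 2) →
      dist u v ≤ 1 := by
    intro e u v hu hv
    have := dist_triangle_right u v e
    rw [Metric.mem_ball] at hu hv
    linarith
  have hfar : ∀ {u : Pt d}, u ∈ Metric.ball c' (1 / 2) → u ∉ Metric.ball c (1 / 2) := by
    intro u hu hu'
    have := dist_triangle_left c c' u
    rw [Metric.mem_ball] at hu hu'
    linarith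
  refine ofReal_le_gammaP hα hs (U := hfin.toFinset.filter (· ∈ Metric.ball c (1 / 2))) i
    (Finset.filter_subset _ _) ⟨x, ?_, y, ?_, hxy.symm, hclose hx.2 hy.2⟩
    ⟨x', ?_, y', ?_, hxy'.symm, hclose hx'.2 hy'.2⟩ ?_
  · exact Finset.mem_filter.2 ⟨hfin.mem_toFinset.2 ⟨hx.1, hA hx.2⟩, hx.2⟩
  · exact Finset.mem_filter.2 ⟨hfin.mem_toFinset.2 ⟨hy.1, hA hy.2⟩, hy.2⟩
  · have := hfar hx'.2
    simp only [Finset.mem_sdiff, Finset.mem_filter, Set.Finite.mem_toFinset]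
    exact ⟨⟨hx'.1, hA' hx'.2⟩, fun h => this h.2⟩
  · have := hfar hy'.2
    simp only [Finset.mem_sdiff, Finset.mem_filter, Set.Finite.mem_toFinset]
    exact ⟨⟨hy'.1, hA' hy'.2⟩, fun h => this h.2⟩
  · intro u hu v hv
    simp only [Finset.mem_sdiff, Finset.mem_filter, Set.Finite.mem_toFinset, not_and] at hu hv
    have hvc : v ∉ Metric.ball c (s + 1) := fun h =>
      hempty.subset ⟨hv.1.1, h, hv.2 hv.1⟩
    have huc := hu.2
    rw [Metric.mem_ball] at hvc huc
    have := dist_triangle_left v c u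
    linarith

lemma cube_subset_closedBall {L : ℝ} (hL : 0 ≤ L) :
    cube d L ⊆ Metric.closedBall (0 : Pt d) (d * L) := by
  intro p hp
  rw [mem_closedBall_zero_iff]
  refine le_of_sq_le_sq ?_ (by positivity)
  rw [EuclideanSpace.norm_sq_eq]
  calc ∑ i, ‖p i‖ ^ 2 ≤ ∑ _i : Fin d, L ^ 2 := by
        refine Finset.sum_le_sum fun i _ => ?_
        have := hp i
        rw [Real.norm_eq_abs]
        exact pow_le_pow_left₀ (abs_nonneg _) (by linarith) 2
    _ = d * L ^ 2 := by simp
    _ ≤ (d * L) ^ 2 := by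
        have : (d : ℝ) ≤ d ^ 2 := by exact_mod_cast Nat.le_self_pow two_ne_zero d
        nlinarith [sq_nonneg L]

lemma ball_single_subset_cube (j : Fin d) {a r L : ℝ} (h : |a| + r ≤ L / 2) :
    Metric.ball (EuclideanSpace.single j a : Pt d) r ⊆ cube d L := by
  intro p hp k
  have h1 : ‖(p - EuclideanSpace.single j a : Pt d) k‖ < r :=
    (PiLp.norm_apply_le _ k).trans_lt (mem_ball_iff_norm.1 hp)
  have h2 : |(EuclideanSpace.single j a : Pt d) k| ≤ |a| := by
    by_cases hk : k = j
    · subst hk; simp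
    · simp [hk]
  have h3 : p k = (p - EuclideanSpace.single j a : Pt d) k + (EuclideanSpace.single j a : Pt d) k := by
    simp
  rw [h3]
  rw [Real.norm_eq_abs] at h1
  have := abs_add_le ((p - EuclideanSpace.single j a : Pt d) k) ((EuclideanSpace.single j a : Pt d) k)
  linarith

lemma ae_eventually_notMem_of_le_div_sq {Ω : Type*} [MeasurableSpace Ω] {μ : Measure Ω}
    {s : ℕ → Set Ω} {C : ℝ} (h : ∀ᶠ L : ℕ in atTop, μ (s L) ≤ ENNReal.ofReal (C / (L : ℝ) ^ 2)) :
    ∀ᵐ ω ∂μ, ∀ᶠ L : ℕ in atTop, ω ∉ s L := by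
  obtain ⟨L₀, hL₀⟩ := eventually_atTop.1 h
  have hsum : Summable fun L : ℕ => C / ((L + L₀ : ℕ) : ℝ) ^ 2 := by
    refine (summable_nat_add_iff (f := fun L : ℕ => C / (L : ℝ) ^ 2) L₀).2 ?_
    simpa [div_eq_mul_inv] using (Real.summable_nat_pow_inv.2 one_lt_two).mul_left C
  have hbc := ae_eventually_notMem (μ := μ) (s := fun L => s (L + L₀))
    (ne_top_of_le_ne_top hsum.tsum_ofReal_ne_top
      (ENNReal.tsum_le_tsum fun L => hL₀ (L + L₀) (Nat.le_add_left _ _)))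
  filter_upwards [hbc] with ω hω
  obtain ⟨n, hn⟩ := eventually_atTop.1 hω
  refine eventually_atTop.2 ⟨n + L₀, fun L hL => ?_⟩
  have := hn (L - L₀) (by omega)
  rwa [Nat.sub_add_cancel (by omega)] at this

lemma eventually_mul_add_one_pow_le {α : ℝ} (hα : (d : ℝ) < α) {κ M : ℝ} (hκ : 0 < κ)
    (hM : 0 < M) :
    ∀ᶠ L : ℕ in atTop,
      κ * ((M * Real.log L) ^ (1 / α) + 1) ^ d ≤ Real.log L / 4 := by
  have hα0 : 0 < α := (Nat.cast_nonneg d).trans_lt hα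
  have hlog : Tendsto (fun L : ℕ => Real.log L) atTop atTop :=
    Real.tendsto_log_atTop.comp tendsto_natCast_atTop_atTop
  have hs : Tendsto (fun L : ℕ => (M * Real.log L) ^ (1 / α)) atTop atTop :=
    (tendsto_rpow_atTop (by positivity)).comp (hlog.const_mul_atTop hM)
  have hlarge : ∀ᶠ x : ℝ in atTop, κ * 2 ^ d * (4 * M) ≤ x ^ (α - d) :=
    (tendsto_rpow_atTop (sub_pos.2 hα)).eventually_ge_atTop _
  filter_upwards [hs.eventually hlarge, hs.eventually_ge_atTop 1, hlog.eventually_ge_atTop 0]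
    with L h1 h2 h3
  set x := (M * Real.log L) ^ (1 / α) with hx
  have hx0 : 0 < x := by linarith
  have hxα : x ^ α = M * Real.log L := by
    rw [hx, ← Real.rpow_mul (by positivity), one_div_mul_cancel hα0.ne', Real.rpow_one]
  have hsplit : x ^ α = x ^ (α - d) * x ^ d := by
    rw [← Real.rpow_natCast x d, ← Real.rpow_add hx0, sub_add_cancel]
  have hkey : 4 * M * (κ * (x + 1) ^ d) ≤ M * Real.log L :=
    calc 4 * M * (κ * (x + 1) ^ d) ≤ 4 * M * (κ * (2 * x) ^ d) := by
          gcongr; linarith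
      _ = κ * 2 ^ d * (4 * M) * x ^ d := by rw [mul_pow]; ring
      _ ≤ x ^ (α - d) * x ^ d := by gcongr
      _ = M * Real.log L := by rw [← hsplit, hxα]
  have : 4 * (κ * (x + 1) ^ d) ≤ Real.log L := by
    refine le_of_mul_le_mul_left ?_ hM
    linarith
  linarith

lemma eventually_two_mul_log_le (q : ℝ) (hq : 0 < q) :
    ∀ᶠ L : ℕ in atTop,
      2 * Real.log L ≤ (Nat.sqrt L : ℝ) * (q * Real.exp (-(Real.log L / 4))) := by
  have ho := (isLittleO_log_rpow_atTop (r := 1 / 4) (by norm_num)).comp_tendsto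
    (tendsto_natCast_atTop_atTop (R := ℝ))
  filter_upwards [ho.bound (show (0 : ℝ) < q / 4 by positivity), eventually_ge_atTop 4] with L h hL
  have hL0 : (0 : ℝ) < L := by exact_mod_cast (by omega : 0 < L)
  simp only [Function.comp, Real.norm_eq_abs] at h
  rw [abs_of_nonneg (Real.rpow_nonneg hL0.le _)] at h
  have h' := (le_abs_self _).trans h
  have hexp : Real.exp (-(Real.log L / 4)) = (L : ℝ) ^ (-(1 / 4) : ℝ) := by
    rw [Real.rpow_def_of_pos hL0]; ring_nf
  have hmul : (L : ℝ) ^ (1 / 2 : ℝ) * (L : ℝ) ^ (-(1 / 4) : ℝ) = (L : ℝ) ^ (1 / 4 : ℝ) := by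
    rw [← Real.rpow_add hL0]; norm_num
  have hsqrt : (L : ℝ) ^ (1 / 2 : ℝ) / 2 ≤ (Nat.sqrt L : ℝ) := by
    rw [← Real.sqrt_eq_rpow]
    have h1 : Real.sqrt L ≤ Nat.sqrt L + 1 := by
      exact Real.real_sqrt_le_nat_sqrt_succ
    have h2 : 2 ≤ Real.sqrt L := Real.le_sqrt_of_sq_le (by norm_num; exact_mod_cast hL)
    linarith
  rw [hexp]
  have hr : (0 : ℝ) < (L : ℝ) ^ (-(1 / 4) : ℝ) := Real.rpow_pos_of_pos hL0 _
  calc 2 * Real.log L ≤ 2 * (q / 4 * (L : ℝ) ^ (1 / 4 : ℝ)) := by linarith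
    _ = (L : ℝ) ^ (1 / 2 : ℝ) / 2 * (q * (L : ℝ) ^ (-(1 / 4) : ℝ)) := by rw [← hmul]; ring
    _ ≤ _ := by gcongr

lemma eventually_sqrt_mul_log_le (a : ℝ) (ha : 0 < a) :
    ∀ᶠ L : ℕ in atTop, (Nat.sqrt L : ℝ) * Real.log L ≤ a * L := by
  have ho := (isLittleO_log_rpow_atTop (r := 1 / 2) (by norm_num)).comp_tendsto
    (tendsto_natCast_atTop_atTop (R := ℝ))
  filter_upwards [ho.bound ha, eventually_ge_atTop 1] with L h hL
  have hL1 : (1 : ℝ) ≤ L := by exact_mod_cast hL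
  simp only [Function.comp, Real.norm_eq_abs] at h
  rw [← Real.sqrt_eq_rpow, abs_of_nonneg (Real.sqrt_nonneg _),
    abs_of_nonneg (Real.log_nonneg hL1)] at h
  calc (Nat.sqrt L : ℝ) * Real.log L ≤ Real.sqrt L * (a * Real.sqrt L) := by
        gcongr
        exact Real.nat_sqrt_le_real_sqrt
    _ = a * L := by
        rw [mul_left_comm, Real.mul_self_sqrt (by positivity)]

lemma IsPoissonPP.ae_eventually_card_lt {ρ : ℝ} (hρ : 0 < ρ) {P : Measure (Config d)}
    (hP : IsPoissonPP d ρ P) :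
    ∀ᵐ ξ ∂P, ∀ᶠ L : ℕ in atTop, ∀ hfin : (ξ ∩ cube d L).Finite,
      hfin.toFinset.card < L ^ (d + 2) := by
  set u := (volume (Metric.ball (0 : Pt d) 1)).toReal with hu
  have hbc := ae_eventually_notMem_of_le_div_sq (μ := P) (C := ρ * (d : ℝ) ^ d * u)
    (s := fun L : ℕ => {ξ | L ^ (d + 2) ≤ (ξ ∩ Metric.closedBall 0 (d * (L : ℝ))).ncard}) (by
      filter_upwards [eventually_ge_atTop 1] with L hL
      have hL0 : (0 : ℝ) < L := by exact_mod_cast hL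
      refine (hP.measure_le_ncard hρ.le Metric.isBounded_closedBall measurableSet_closedBall
        (by positivity)).trans (ENNReal.ofReal_le_ofReal (le_of_eq ?_))
      rw [Measure.addHaar_closedBall _ _ (by positivity), ENNReal.toReal_mul,
        ENNReal.toReal_ofReal (by positivity), finrank_euclideanSpace_fin, ← hu]
      push_cast
      rw [mul_pow, pow_add]
      field_simp)
  filter_upwards [hbc, hP.2.1] with ξ hξ hlf
  filter_upwards [hξ] with L hL hfin
  rw [not_le] at hL
  refine lt_of_le_of_lt ?_ hL
  rw [← Set.ncard_eq_toFinset_card _ hfin]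
  exact Set.ncard_le_ncard
    (Set.inter_subset_inter_right _ (cube_subset_closedBall (Nat.cast_nonneg L)))
    (hlf _ Metric.isBounded_closedBall)

/-- Centres spaced by `2 (s + 1)` along the coordinate axis `j`. -/
def axisCentre (j : Fin d) (s : ℝ) (k : ℕ) : Pt d :=
  EuclideanSpace.single j (2 * (s + 1) * k)

lemma le_dist_axisCentre (j : Fin d) {s : ℝ} (hs : 0 ≤ s) :
    Pairwise fun k l => 2 * (s + 1) ≤ dist (axisCentre j s k) (axisCentre j s l) := by
  intro k l hkl
  have h1 : (1 : ℝ) ≤ |(k : ℝ) - l| := by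
    have : (1 : ℤ) ≤ |(k : ℤ) - l| := Int.one_le_abs (sub_ne_zero.2 (by exact_mod_cast hkl))
    exact_mod_cast this
  unfold axisCentre
  rw [PiLp.dist_single_same, Real.dist_eq, ← mul_sub, abs_mul, abs_of_pos (by positivity)]
  nlinarith

lemma IsPoissonPP.ae_eventually_exists_isolatedPair {α : ℝ} (hα : (d : ℝ) < α) {ρ : ℝ}
    (hρ : 0 < ρ) {P : Measure (Config d)} (hP : IsPoissonPP d ρ P) (j : Fin d) {M : ℝ}
    (hM : 0 < M) (S : ℕ → Finset ℕ) (hS : ∀ L, (S L).card = Nat.sqrt L) :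
    ∀ᵐ ξ ∂P, ∀ᶠ L : ℕ in atTop, ∃ k ∈ S L,
      ξ ∈ IsolatedPair (axisCentre j ((M * Real.log L) ^ (1 / α)) k)
        ((M * Real.log L) ^ (1 / α)) := by
  obtain ⟨q, κ, hq, hκ, hle⟩ := IsPoissonPP.le_measure_isolatedPair (d := d) hρ
  have hbc := ae_eventually_notMem_of_le_div_sq (μ := P) (C := 1)
    (s := fun L : ℕ => {ξ | ∀ k ∈ S L,
      ξ ∉ IsolatedPair (axisCentre j ((M * Real.log L) ^ (1 / α)) k)
        ((M * Real.log L) ^ (1 / α))}) (by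
      filter_upwards [eventually_mul_add_one_pow_le hα hκ hM, eventually_two_mul_log_le q hq,
        eventually_ge_atTop 1] with L h1 h2 hL
      have hL1 : (1 : ℝ) ≤ L := by exact_mod_cast hL
      have hs : 0 ≤ (M * Real.log L) ^ (1 / α) :=
        Real.rpow_nonneg (mul_nonneg hM.le (Real.log_nonneg hL1)) _
      refine (hP.measure_forall_notMem_isolatedPair_le hs (le_dist_axisCentre j hs)
        (p := q * Real.exp (-(κ * ((M * Real.log L) ^ (1 / α) + 1) ^ d))) (by positivity)
        (fun k => hle P hP _ _ hs) (S L)).trans (ENNReal.ofReal_le_ofReal ?_)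
      have hlog : (1 : ℝ) / (L : ℝ) ^ 2 = Real.exp (-(2 * Real.log L)) := by
        rw [Real.exp_neg, two_mul, Real.exp_add, Real.exp_log (by positivity), one_div, pow_two]
      rw [hlog, hS]
      refine Real.exp_le_exp.2 (neg_le_neg (h2.trans ?_))
      gcongr)
  filter_upwards [hbc] with ξ hξ
  filter_upwards [hξ] with L hL
  simpa using hL

/-- Theorem 1.3(1): subdiffusive lower bound for `α > d`. -/
theorem stmt_4 (hd : 2 ≤ d) (α : ℝ) (hα : (d : ℝ) < α) (ρ : ℝ) (hρ : 0 < ρ)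
    (P : Measure (Config d)) (hP : IsPoissonPP d ρ P)
    (i : ℕ) (hi : i ∈ ({1, 2, 3} : Set ℕ)) (δ : ℝ) (hδ : 0 < δ) :
    ∀ᵐ ξ ∂P, ∀ᶠ L : ℕ in atTop, ∀ hfin : (ξ ∩ cube d L).Finite,
      ENNReal.ofReal ((L : ℝ) ^ (1 / δ)) ≤ gammaP α hfin.toFinset i := by
  have hα0 : 0 < α := (Nat.cast_nonneg d).trans_lt hα
  let j : Fin d := ⟨0, by omega⟩
  set M : ℝ := 1 / δ + 4 * (d + 2) + 1 with hMdef
  have hM : 0 < M := by positivity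
  filter_upwards [hP.2.1, hP.ae_eventually_card_lt hρ,
    hP.ae_eventually_exists_isolatedPair hα hρ j hM (fun L => Finset.range (Nat.sqrt L))
      (fun L => by simp),
    hP.ae_eventually_exists_isolatedPair hα hρ j hM
      (fun L => Finset.Ico (Nat.sqrt L) (2 * Nat.sqrt L))
      (fun L => by rw [Nat.card_Ico]; omega)] with ξ hlf hcard hpair hpair'
  filter_upwards [hcard, hpair, hpair', eventually_mul_add_one_pow_le hα one_pos hM,
    eventually_sqrt_mul_log_le (1 / 4) (by norm_num), eventually_ge_atTop 8]
    with L hN ⟨k, hk, hξk⟩ ⟨l, hl, hξl⟩ hpow hsqrt hL hfin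
  have hL8 : (8 : ℝ) ≤ L := by exact_mod_cast hL
  have hL0 : (0 : ℝ) < L := by linarith
  have hlog : 0 ≤ Real.log L := Real.log_nonneg (by linarith)
  set s : ℝ := (M * Real.log L) ^ (1 / α) with hs
  have hs0 : 0 ≤ s := Real.rpow_nonneg (by positivity) _
  have hsα : Real.exp (s ^ α) = (L : ℝ) ^ M := by
    rw [hs, ← Real.rpow_mul (by positivity), one_div_mul_cancel hα0.ne', Real.rpow_one,
      Real.rpow_def_of_pos hL0, mul_comm]
  have hs1 : s + 1 ≤ Real.log L / 4 :=
    calc s + 1 ≤ (s + 1) ^ d := le_self_pow₀ (by linarith) (by omega)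
      _ ≤ Real.log L / 4 := by linarith
  have hcube : ∀ m : ℕ, m < 2 * Nat.sqrt L →
      Metric.ball (axisCentre j s m) (1 / 2) ⊆ cube d L := by
    intro m hm
    refine ball_single_subset_cube j ?_
    rw [abs_of_nonneg (by positivity)]
    have hm' : (m : ℝ) ≤ 2 * Nat.sqrt L := by exact_mod_cast hm.le
    have : 2 * (s + 1) * m ≤ 2 * (Real.log L / 4) * (2 * Nat.sqrt L) := by gcongr
    nlinarith
  rw [Finset.mem_range] at hk
  rw [Finset.mem_Ico] at hl
  refine le_trans (ENNReal.ofReal_le_ofReal ?_) (ofReal_le_gammaP_of_isolatedPair hα0.le hs0 hlf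
    (le_dist_axisCentre j hs0 (by omega : k ≠ l)) hξk hξl (hcube k (by omega)) (hcube l hl.2)
    hfin i)
  have hne : 0 < hfin.toFinset.card := by
    obtain ⟨x, y, -, hxy⟩ := Set.ncard_eq_two.1 hξk.1
    have hx : x ∈ ξ ∩ Metric.ball (axisCentre j s k) (1 / 2) := hxy ▸ Set.mem_insert _ _
    exact Finset.card_pos.2 ⟨x, hfin.mem_toFinset.2 ⟨hx.1, hcube k (by omega) hx.2⟩⟩
  have hN0 : (0 : ℝ) < hfin.toFinset.card := by exact_mod_cast hne
  have hNle : (hfin.toFinset.card : ℝ) ≤ (L : ℝ) ^ (d + 2) := by exact_mod_cast (hN hfin).le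
  have hexp : 1 ≤ Real.exp (-2) * L := by
    have h2 : Real.exp 2 ≤ 8 := by
      have h := Real.exp_one_lt_d9.le
      have : Real.exp 2 = Real.exp 1 * Real.exp 1 := by rw [← Real.exp_add]; norm_num
      rw [this]
      nlinarith [Real.exp_pos 1]
    rw [Real.exp_neg, inv_mul_eq_div, one_le_div (Real.exp_pos _)]
    linarith
  rw [le_div_iff₀ (by positivity), hsα]
  have hsplit : (L : ℝ) ^ M = (L : ℝ) ^ (1 / δ) * ((L : ℝ) ^ (d + 2)) ^ 4 * L := by
    rw [hMdef, Real.rpow_add hL0, Real.rpow_add hL0, Real.rpow_one, ← pow_mul,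
      ← Real.rpow_natCast _ ((d + 2) * 4)]
    push_cast
    ring_nf
  calc (L : ℝ) ^ (1 / δ) * (hfin.toFinset.card : ℝ) ^ 4
      ≤ (L : ℝ) ^ (1 / δ) * ((L : ℝ) ^ (d + 2)) ^ 4 := by gcongr
    _ ≤ (L : ℝ) ^ (1 / δ) * ((L : ℝ) ^ (d + 2)) ^ 4 * (Real.exp (-2) * L) :=
        le_mul_of_one_le_right (by positivity) hexp
    _ = Real.exp (-2) * (L : ℝ) ^ M := by rw [hsplit]; ring

end
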